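/- Let L/K be a finite extension of number fields and let δ_{L/K} ∈ K^× be the discriminant of the relative trace form of L over K with respect to some K-basis of L, i.e., the determinant of the matrix (Tr_{L/K}(b_i b_j)) for a K-basis b_1, …, b_n of L. Then the fractional ideal Δ_{L/K} · (δ_{L/K} 𝒪_K)^{−1} is the square of a fractional ideal 𝔞 of K, i.e., Δ_{L/K} = δ_{L/K} 𝔞², and the ideal class of 𝔞 in Cl(K) is the Steinitz class St(𝒪_L) of L over K. -/

import Mathlib

open NumberField
open scoped nonZeroDivisors

noncomputable section

/-- The relative discriminant ideal of `L/K`. -/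
def relDisc (K L : Type*) [Field K] [NumberField K] [Field L] [Algebra K L] :
    Ideal (𝓞 K) :=
  Ideal.span {d : 𝓞 K | ∃ b : Module.Basis (Fin (Module.finrank K L)) K L,
    (∀ i, IsIntegral ℤ (b i)) ∧ algebraMap (𝓞 K) K d = Algebra.discr K ⇑b}

/-- `c` is the Steinitz class of `L/K`. -/
def IsSteinitzClass (K : Type*) [Field K] [NumberField K] (L : Type*) [Field L]
    [Algebra K L] (c : ClassGroup (𝓞 K)) : Prop :=
  ∃ I : (Ideal (𝓞 K))⁰, ClassGroup.mk0 I = c ∧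
    Nonempty ((𝓞 L) ≃ₗ[𝓞 K] ((Fin (Module.finrank K L - 1) → 𝓞 K) × (I : Ideal (𝓞 K))))

/-- In a Dedekind domain, the square of an ideal is generated by the squares of generators. -/
theorem Ideal.span_sq_eq_span_image_sq {R : Type*} [CommRing R] [IsDedekindDomain R]
    (S : Set R) : Ideal.span S ^ 2 = Ideal.span ((fun r => r ^ 2) '' S) := by
  apply le_antisymm
  · rw [pow_two, Ideal.span_mul_span', Ideal.span_le]
    rintro _ ⟨g, hg, h, hh, rfl⟩
    have key : Ideal.span {g, h} * Ideal.span {g, h} = Ideal.span {g ^ 2, h ^ 2} := by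
      by_cases h0 : Ideal.span {g, h} = 0
      · have hg0 : g = 0 := by
          rw [← Ideal.mem_bot, ← Ideal.zero_eq_bot, ← h0]
          exact Ideal.subset_span (by simp)
        have hh0 : h = 0 := by
          rw [← Ideal.mem_bot, ← Ideal.zero_eq_bot, ← h0]
          exact Ideal.subset_span (by simp)
        simp [hg0, hh0]
      · apply mul_right_cancel₀ h0
        rw [Ideal.span_pair_mul_span_pair, Ideal.span_pair_mul_span_pair, Ideal.span_mul_span']
        apply le_antisymm
        · rw [Ideal.span_le]
          rintro _ ⟨u, hu, v, hv, rfl⟩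
          simp only [Set.mem_insert_iff, Set.mem_singleton_iff] at hu hv
          apply Ideal.subset_span
          simp only [Set.mem_insert_iff, Set.mem_singleton_iff]
          rcases hu with rfl | rfl | rfl | rfl <;> rcases hv with rfl | rfl <;> grind
        · rw [Ideal.span_le]
          intro r hr
          simp only [Set.mem_insert_iff, Set.mem_singleton_iff] at hr
          apply Ideal.subset_span
          rcases hr with rfl | rfl | rfl | rfl
          · exact ⟨g * g, by simp, g, by simp, by ring⟩
          · exact ⟨g * g, by simp, h, by simp, by ring⟩
          · exact ⟨h * h, by simp, g, by simp, by ring⟩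
          · exact ⟨h * h, by simp, h, by simp, by ring⟩
    have hle : Ideal.span {g ^ 2, h ^ 2} ≤ Ideal.span ((fun r => r ^ 2) '' S) := by
      apply Ideal.span_mono
      rintro r (rfl | rfl)
      · exact ⟨g, hg, rfl⟩
      · exact ⟨h, hh, rfl⟩
    apply hle
    rw [← key]
    exact Ideal.mul_mem_mul (Ideal.subset_span (by simp)) (Ideal.subset_span (by simp))
  · rw [Ideal.span_le]
    rintro _ ⟨g, hg, rfl⟩
    exact Ideal.pow_mem_pow (Ideal.subset_span hg) 2

/-- The determinant of a matrix one of whose rows has entries in `I` lies in `I`. -/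
theorem Matrix.det_mem_of_row_mem {R ι : Type*} [CommRing R] [Fintype ι] [DecidableEq ι]
    (I : Ideal R) (A : Matrix ι ι R) (i : ι) (h : ∀ j, A i j ∈ I) : A.det ∈ I := by
  rw [← Ideal.Quotient.eq_zero_iff_mem, RingHom.map_det]
  exact Matrix.det_eq_zero_of_row_eq_zero i fun j => Ideal.Quotient.eq_zero_iff_mem.2 (h j)

/-- The discriminant of a family is the discriminant of a basis times the squared
determinant of the family in that basis. -/
theorem Module.Basis.discr_eq_det_sq_mul_discr {A B ι : Type*} [CommRing A] [CommRing B]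
    [Algebra A B] [Fintype ι] [DecidableEq ι] (b : Module.Basis ι A B) (v : ι → B) :
    Algebra.discr A v = b.det v ^ 2 * Algebra.discr A ⇑b := by
  rw [Module.Basis.det_apply, ← Algebra.discr_of_matrix_vecMul, Module.Basis.toMatrix_map_vecMul]

section

variable {K : Type*} [Field K] {L : Type*} [Field L] [Algebra K L]
  {ι : Type*} [Fintype ι]

/-- Every element of a number field has a nonzero integral multiple. -/
theorem NumberField.exists_int_smul_isIntegral [NumberField L] (z : L) :
    ∃ r : ℤ, r ≠ 0 ∧ IsIntegral ℤ (r • z) :=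
  ((IsFractionRing.isAlgebraic_iff ℤ ℚ L).2
    (Algebra.IsAlgebraic.isAlgebraic z)).exists_integral_multiple

/-- A decomposition `𝓞 L ≃ (𝓞 K)ⁿ⁻¹ × I` yields a pseudo-basis of `𝓞 L` whose coefficient ideals
are trivial except for one, which is `I`. -/
theorem exists_pseudoBasis [NumberField K] [NumberField L] (b : Module.Basis ι K L)
    {I : Ideal (𝓞 K)} (hI : I ≠ ⊥)
    (φ : (𝓞 L) ≃ₗ[𝓞 K] ((Fin (Module.finrank K L - 1) → 𝓞 K) × I)) :
    ∃ (i₀ : ι) (e : Module.Basis ι K L),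
      (∀ m : 𝓞 L, ∃ c : ι → 𝓞 K, c i₀ ∈ I ∧ (m : L) = ∑ i, algebraMap (𝓞 K) K (c i) • e i) ∧
      (∀ i ≠ i₀, IsIntegral ℤ (e i)) ∧
      ∀ s ∈ I, IsIntegral ℤ (algebraMap (𝓞 K) K s • e i₀) := by
  have : FiniteDimensional K L := Module.Finite.of_basis b
  obtain ⟨t, htI, ht⟩ := Submodule.exists_mem_ne_zero_of_ne_bot hI
  have htK : algebraMap (𝓞 K) K t ≠ 0 := (FaithfulSMul.algebraMap_eq_zero_iff (𝓞 K) K).not.2 ht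
  have hsmul (r : 𝓞 K) (z : 𝓞 L) : ((r • z : 𝓞 L) : L) = algebraMap (𝓞 K) K r • (z : L) := by
    change algebraMap (𝓞 L) L _ = _ • algebraMap (𝓞 L) L _
    rw [algebraMap_smul, Algebra.smul_def, Algebra.smul_def, map_mul,
      ← IsScalarTower.algebraMap_apply]
  let g : Option (Fin (Module.finrank K L - 1)) → L := fun o =>
    o.elim ((algebraMap (𝓞 K) K t)⁻¹ • ((φ.symm (0, ⟨t, htI⟩) : 𝓞 L) : L))
      fun j => ((φ.symm (Pi.single j 1, 0) : 𝓞 L) : L)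
  have hlast (s : 𝓞 K) (hs : s ∈ I) :
      ((φ.symm (0, ⟨s, hs⟩) : 𝓞 L) : L) = algebraMap (𝓞 K) K s • g none := by
    have hcomm : t • φ.symm (0, ⟨s, hs⟩) = s • φ.symm (0, ⟨t, htI⟩) := by
      rw [← map_smul, ← map_smul]
      congr 1
      ext
      · simp
      · simp [mul_comm]
    have hcommL := congrArg (fun z : 𝓞 L => (z : L)) hcomm
    simp only [hsmul] at hcommL
    simp only [g, Option.elim]
    rw [smul_comm, ← hcommL, inv_smul_smul₀ htK]
  have hrep (m : 𝓞 L) : (m : L) =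
      ∑ o, algebraMap (𝓞 K) K (o.elim ((φ m).2 : 𝓞 K) fun j => (φ m).1 j) • g o := by
    have hm : m = φ.symm (0, (φ m).2) + ∑ j, (φ m).1 j • φ.symm (Pi.single j 1, 0) := by
      apply φ.injective
      simp only [map_add, map_sum, map_smul, LinearEquiv.apply_symm_apply]
      ext j
      · simp [Prod.fst_sum, Finset.sum_apply, Pi.single_apply]
      · simp [Prod.snd_sum]
    conv_lhs => rw [hm]
    change algebraMap (𝓞 L) L _ = _
    rw [Fintype.sum_option, map_add, map_sum]
    congr 1
    · exact hlast _ (φ m).2.2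
    · exact Finset.sum_congr rfl fun j _ => hsmul _ _
  have hspan : ⊤ ≤ Submodule.span K (Set.range g) := by
    intro z _
    obtain ⟨r, hr, hint⟩ := exists_int_smul_isIntegral z
    have hmem : (r : K) • z ∈ Submodule.span K (Set.range g) := by
      rw [Int.cast_smul_eq_zsmul]
      have hz := hrep ⟨r • z, hint⟩
      change r • z = _ at hz
      rw [hz]
      exact Submodule.sum_mem _ fun o _ =>
        Submodule.smul_mem _ _ (Submodule.subset_span ⟨o, rfl⟩)
    rwa [Submodule.smul_mem_iff _ (Int.cast_ne_zero.2 hr)] at hmem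
  have hpos : 0 < Module.finrank K L := Module.finrank_pos
  have hcard : Fintype.card (Option (Fin (Module.finrank K L - 1))) = Module.finrank K L := by
    rw [Fintype.card_option, Fintype.card_fin, Nat.sub_add_cancel hpos]
  let e := basisOfTopLeSpanOfCardEqFinrank g hspan hcard
  have he : ⇑e = g := coe_basisOfTopLeSpanOfCardEqFinrank g hspan hcard
  let f : Option (Fin (Module.finrank K L - 1)) ≃ ι :=
    Fintype.equivOfCardEq (hcard.trans (Module.finrank_eq_card_basis b))
  refine ⟨f none, e.reindex f, fun m => ⟨fun i => (f.symm i).elim ((φ m).2 : 𝓞 K)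
    fun j => (φ m).1 j, ?_, ?_⟩, fun i hi => ?_, fun s hs => ?_⟩
  · simp
  · rw [hrep m]
    refine Fintype.sum_equiv f _ _ fun o => ?_
    simp [he]
  · rw [Module.Basis.reindex_apply, he]
    obtain ⟨j, hj⟩ := Option.ne_none_iff_exists'.1
      (fun h => hi ((Equiv.symm_apply_eq f).1 h) : f.symm i ≠ none)
    rw [hj]
    exact RingOfIntegers.isIntegral_coe _
  · rw [Module.Basis.reindex_apply, he, Equiv.symm_apply_apply, ← hlast s hs]
    exact RingOfIntegers.isIntegral_coe _

variable [DecidableEq ι]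

/-- The relative discriminant ideal is generated by the discriminants of all families of
integers indexed by a type of the right cardinality. -/
theorem relDisc_eq_span_discr [NumberField K] (b : Module.Basis ι K L) :
    relDisc K L = Ideal.span {d : 𝓞 K | ∃ m : ι → 𝓞 L,
      algebraMap (𝓞 K) K d = Algebra.discr K fun i => (m i : L)} := by
  have : FiniteDimensional K L := Module.Finite.of_basis b
  have hcard : Fintype.card ι = Module.finrank K L := (Module.finrank_eq_card_basis b).symm
  let f : ι ≃ Fin (Module.finrank K L) := Fintype.equivFinOfCardEq hcard
  apply le_antisymm
  · refine Ideal.span_mono ?_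
    rintro d ⟨v, hv, hd⟩
    refine ⟨fun i => ⟨v (f i), hv _⟩, ?_⟩
    rw [hd, ← Algebra.discr_reindex K v f.symm]
    rfl
  · rw [relDisc, Ideal.span_le]
    rintro d ⟨m, hd⟩
    by_cases hli : LinearIndependent K fun i => (m i : L)
    · have : Nonempty ι := b.index_nonempty
      let v := basisOfLinearIndependentOfCardEqFinrank hli hcard
      have hv : ⇑v = fun i => (m i : L) := coe_basisOfLinearIndependentOfCardEqFinrank hli hcard
      refine Ideal.subset_span ⟨v.reindex f, fun i => ?_, ?_⟩
      · rw [Module.Basis.reindex_apply, hv]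
        exact RingOfIntegers.isIntegral_coe _
      · rw [hd, Module.Basis.coe_reindex, Algebra.discr_reindex, hv]
    · rw [Algebra.discr_zero_of_not_linearIndependent K hli] at hd
      rw [(FaithfulSMul.algebraMap_eq_zero_iff (𝓞 K) K).1 hd]
      exact Ideal.zero_mem _

/-- The ideal generated by the multiples by `x` of the determinants, in the basis `b`, of
families of integers of `L`. -/
def detIdeal (b : Module.Basis ι K L) (x : 𝓞 K) : Ideal (𝓞 K) :=
  Ideal.span {α : 𝓞 K | ∃ m : ι → 𝓞 L,
    algebraMap (𝓞 K) K α = algebraMap (𝓞 K) K x * b.det fun i => (m i : L)}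

/-- If the discriminant of `b` is `x / y`, then `x` is a common denominator for the determinants
in the basis `b` of families of integers. -/
theorem exists_algebraMap_eq_mul_det (b : Module.Basis ι K L) {x y : 𝓞 K}
    (hxy : algebraMap (𝓞 K) K x = Algebra.discr K ⇑b * algebraMap (𝓞 K) K y) (m : ι → 𝓞 L) :
    ∃ α : 𝓞 K, algebraMap (𝓞 K) K α = algebraMap (𝓞 K) K x * b.det fun i => (m i : L) := by
  have : FiniteDimensional K L := Module.Finite.of_basis b
  have hint : IsIntegral ℤ (algebraMap (𝓞 K) K x * b.det fun i => (m i : L)) := by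
    refine IsIntegral.of_pow (n := 2) two_pos ?_
    have hsq : (algebraMap (𝓞 K) K x * b.det fun i => (m i : L)) ^ 2 =
        algebraMap (𝓞 K) K x * algebraMap (𝓞 K) K y *
          Algebra.discr K fun i => (m i : L) := by
      rw [b.discr_eq_det_sq_mul_discr]
      linear_combination (algebraMap (𝓞 K) K x * (b.det fun i => (m i : L)) ^ 2) * hxy
    rw [hsq]
    exact ((RingOfIntegers.isIntegral_coe x).mul (RingOfIntegers.isIntegral_coe y)).mul
      (Algebra.discr_isIntegral K fun i => RingOfIntegers.isIntegral_coe (m i))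
  exact ⟨⟨_, hint⟩, rfl⟩

theorem detIdeal_ne_bot [NumberField K] [NumberField L] (b : Module.Basis ι K L)
    {x y : 𝓞 K} (hx : x ≠ 0)
    (hxy : algebraMap (𝓞 K) K x = Algebra.discr K ⇑b * algebraMap (𝓞 K) K y) :
    detIdeal b x ≠ ⊥ := by
  choose r hr hrb using fun i => exists_int_smul_isIntegral (b i)
  obtain ⟨α, hα⟩ := exists_algebraMap_eq_mul_det b hxy fun i => ⟨r i • b i, hrb i⟩
  have hdet : (b.det fun i => r i • b i) ≠ 0 := by
    have heq : (fun i => r i • b i) = fun i => (r i : K) • b i := by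
      ext i
      rw [Int.cast_smul_eq_zsmul]
    rw [heq, AlternatingMap.map_smul_univ, b.det_self]
    simpa [Finset.prod_eq_zero_iff] using hr
  intro hbot
  have hmem : α ∈ detIdeal b x := Ideal.subset_span ⟨_, hα⟩
  rw [hbot, Ideal.mem_bot] at hmem
  rw [hmem, map_zero] at hα
  exact mul_ne_zero ((FaithfulSMul.algebraMap_eq_zero_iff (𝓞 K) K).not.2 hx) hdet hα.symm

/-- The square of the ideal of determinants computes the relative discriminant. -/
theorem span_mul_relDisc_eq [NumberField K] [NumberField L] (b : Module.Basis ι K L) {x y : 𝓞 K}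
    (hxy : algebraMap (𝓞 K) K x = Algebra.discr K ⇑b * algebraMap (𝓞 K) K y) :
    Ideal.span {y} * Ideal.span {x} ^ 2 * relDisc K L = Ideal.span {x} * detIdeal b x ^ 2 := by
  have : FiniteDimensional K L := Module.Finite.of_basis b
  have hinj := FaithfulSMul.algebraMap_injective (𝓞 K) K
  have key {m : ι → 𝓞 L} {d α : 𝓞 K}
      (hd : algebraMap (𝓞 K) K d = Algebra.discr K fun i => (m i : L))
      (hα : algebraMap (𝓞 K) K α = algebraMap (𝓞 K) K x * b.det fun i => (m i : L)) :
      y * x ^ 2 * d = x * α ^ 2 := by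
    apply hinj
    simp only [map_mul, map_pow, hd, hα, b.discr_eq_det_sq_mul_discr fun i => (m i : L)]
    linear_combination
      (-(algebraMap (𝓞 K) K x) ^ 2 * (b.det fun i => (m i : L)) ^ 2) * hxy
  rw [detIdeal, relDisc_eq_span_discr b, Ideal.span_singleton_pow, Ideal.span_sq_eq_span_image_sq,
    Ideal.span_singleton_mul_span_singleton, Ideal.span_mul_span', Ideal.span_mul_span',
    Set.singleton_mul, Set.singleton_mul]
  congr 1
  ext z
  constructor
  · rintro ⟨d, ⟨m, hd⟩, rfl⟩
    obtain ⟨α, hα⟩ := exists_algebraMap_eq_mul_det b hxy m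
    exact ⟨_, ⟨α, ⟨m, hα⟩, rfl⟩, (key hd hα).symm⟩
  · rintro ⟨_, ⟨α, ⟨m, hα⟩, rfl⟩, rfl⟩
    have hd : IsIntegral ℤ (Algebra.discr K fun i => (m i : L)) :=
      Algebra.discr_isIntegral K fun i => RingOfIntegers.isIntegral_coe (m i)
    exact ⟨⟨_, hd⟩, ⟨m, rfl⟩, key (d := ⟨_, hd⟩) rfl hα⟩

/-- The ideal of determinants represents the Steinitz class. -/
theorem mk0_detIdeal_eq [NumberField K] [NumberField L] (b : Module.Basis ι K L)
    {x y : 𝓞 K} (hx : x ≠ 0)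
    (hxy : algebraMap (𝓞 K) K x = Algebra.discr K ⇑b * algebraMap (𝓞 K) K y)
    (I a : (Ideal (𝓞 K))⁰) (ha : (a : Ideal (𝓞 K)) = detIdeal b x)
    (φ : (𝓞 L) ≃ₗ[𝓞 K] ((Fin (Module.finrank K L - 1) → 𝓞 K) × (I : Ideal (𝓞 K)))) :
    ClassGroup.mk0 I = ClassGroup.mk0 a := by
  have hinj := FaithfulSMul.algebraMap_injective (𝓞 K) K
  have hI : (I : Ideal (𝓞 K)) ≠ ⊥ := nonZeroDivisors.coe_ne_zero I
  obtain ⟨i₀, e, hrep, hint, hint₀⟩ := exists_pseudoBasis b hI φ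
  obtain ⟨p, q, hq, hpq⟩ := IsFractionRing.div_surjective (A := 𝓞 K)
    (algebraMap (𝓞 K) K x * b.det e)
  have hq0 : q ≠ 0 := nonZeroDivisors.ne_zero hq
  have hqK : algebraMap (𝓞 K) K q ≠ 0 := (FaithfulSMul.algebraMap_eq_zero_iff (𝓞 K) K).not.2 hq0
  rw [div_eq_iff hqK] at hpq
  have hp0 : p ≠ 0 := by
    rintro rfl
    rw [map_zero] at hpq
    exact mul_ne_zero (mul_ne_zero ((FaithfulSMul.algebraMap_eq_zero_iff (𝓞 K) K).not.2 hx)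
      (b.isUnit_det e).ne_zero) hqK hpq.symm
  refine ClassGroup.mk0_eq_mk0_iff.2 ⟨p, q, hp0, hq0, ?_⟩
  rw [ha]
  apply le_antisymm
  · rw [Ideal.span_singleton_mul_le_iff]
    intro s hs
    have hm (i : ι) : IsIntegral ℤ (Function.update e i₀ (algebraMap (𝓞 K) K s • e i₀) i) := by
      rcases eq_or_ne i i₀ with rfl | hi
      · rw [Function.update_self]
        exact hint₀ s hs
      · rw [Function.update_of_ne hi]
        exact hint i hi
    obtain ⟨α, hα⟩ := exists_algebraMap_eq_mul_det b hxy fun i => ⟨_, hm i⟩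
    have hdet : (b.det fun i => Function.update e i₀ (algebraMap (𝓞 K) K s • e i₀) i) =
        algebraMap (𝓞 K) K s * b.det e := by
      rw [AlternatingMap.map_update_smul, Function.update_eq_self, smul_eq_mul]
    refine Ideal.mem_span_singleton_mul.2 ⟨α, Ideal.subset_span ⟨_, hα⟩, hinj ?_⟩
    replace hα := hα.trans (congrArg _ hdet)
    rw [map_mul, map_mul, hα, hpq]
    ring
  · rw [detIdeal, Ideal.span_mul_span', Ideal.span_le, Set.singleton_mul]
    rintro _ ⟨α, ⟨m, hα⟩, rfl⟩
    choose c hcI hc using fun j => hrep (m j)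
    let C : Matrix ι ι (𝓞 K) := Matrix.of fun i j => c j i
    have hC : e.toMatrix (fun j => (m j : L)) = C.map (algebraMap (𝓞 K) K) := by
      ext i j
      rw [Module.Basis.toMatrix_apply, hc j, e.repr_sum_self]
      rfl
    have hdet : (b.det fun j => (m j : L)) = b.det e * algebraMap (𝓞 K) K C.det := by
      rw [Module.Basis.det_apply, Module.Basis.det_apply, RingHom.map_det, RingHom.mapMatrix_apply,
        ← hC, ← Matrix.det_mul, Module.Basis.toMatrix_mul_toMatrix]
    refine Ideal.mem_span_singleton_mul.2
      ⟨C.det, Matrix.det_mem_of_row_mem _ C i₀ hcI, hinj ?_⟩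
    rw [map_mul, map_mul, hα, hdet, hpq]
    ring

end

/-- **Artin's theorem on the Steinitz class.**
Let `L/K` be a finite extension of number fields and let `δ = disc(Tr_{L/K}(bᵢbⱼ))` be the
discriminant of the relative trace form with respect to a `K`-basis `b` of `L`.  Then the
fractional ideal `Δ_{L/K}·(δ𝒪_K)⁻¹` is the square of a fractional ideal `𝔞 = a/b'`
(written below as `y·b'²·Δ_{L/K} = x·a²` with `δ = x/y`), and the class of `𝔞` is the
Steinitz class of `L/K`. -/
theorem artin_steinitz_trace_form
    (K : Type*) [Field K] [NumberField K]
    (L : Type*) [Field L] [NumberField L] [Algebra K L]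
    (ι : Type*) [Fintype ι] [DecidableEq ι] (b : Module.Basis ι K L) :
    ∃ (x y : 𝓞 K) (a b' : (Ideal (𝓞 K))⁰), x ≠ 0 ∧ y ≠ 0 ∧
      -- `δ_{L/K} = x/y`, where `δ_{L/K} = det (Tr_{L/K}(bᵢ bⱼ)) = disc(b)`
      algebraMap (𝓞 K) K x = Algebra.discr K ⇑b * algebraMap (𝓞 K) K y ∧
      -- `Δ_{L/K} = δ_{L/K} · (a/b')²` as fractional ideals
      Ideal.span {y} * (b' : Ideal (𝓞 K)) ^ 2 * relDisc K L =
        Ideal.span {x} * (a : Ideal (𝓞 K)) ^ 2 ∧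
      -- and the class of `𝔞 = a/b'` is the Steinitz class of `L/K`
      ∀ c : ClassGroup (𝓞 K), IsSteinitzClass K L c →
        c = ClassGroup.mk0 a * (ClassGroup.mk0 b')⁻¹ := by
  have : FiniteDimensional K L := Module.Finite.of_basis b
  have hδ : Algebra.discr K ⇑b ≠ 0 := Algebra.discr_not_zero_of_basis K b
  obtain ⟨x, y, hy, hxy⟩ := IsFractionRing.div_surjective (A := 𝓞 K) (Algebra.discr K ⇑b)
  have hy0 : y ≠ 0 := nonZeroDivisors.ne_zero hy
  have hx0 : x ≠ 0 := by
    rintro rfl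
    exact hδ (by rw [← hxy, map_zero, zero_div])
  rw [div_eq_iff ((FaithfulSMul.algebraMap_eq_zero_iff (𝓞 K) K).not.2 hy0)] at hxy
  have hspan : Ideal.span {x} ≠ ⊥ := by simpa using hx0
  refine ⟨x, y, ⟨detIdeal b x, mem_nonZeroDivisors_of_ne_zero (detIdeal_ne_bot b hx0 hxy)⟩,
    ⟨Ideal.span {x}, mem_nonZeroDivisors_of_ne_zero hspan⟩, hx0, hy0, hxy,
    span_mul_relDisc_eq b hxy, ?_⟩
  rintro c ⟨I, rfl, ⟨φ⟩⟩
  rw [(ClassGroup.mk0_eq_one_iff _).2 ⟨⟨x, rfl⟩⟩, inv_one, mul_one]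
  exact mk0_detIdeal_eq b hx0 hxy I _ rfl φ


end
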